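/- arXiv:2312.03638 — 2 statements merged into one kernel-verified Lean document; each statement's English description precedes it below -/
import Mathlib

section
/- Let L = U^3 ⊕ E8^2 and define the involution I_dP by (v,u,u',e,e') ↦ (-v,u',u,-e,-e'). Then the fixed sublattice L^{I_dP=1} is isomorphic to U(2), and the anti-fixed sublattice L^{I_dP=-1} is isomorphic to U ⊕ U(2) ⊕ E8^2. -/
noncomputable section

/-- The hyperbolic plane lattice `U`, as `ℤ²`. -/
abbrev ULat := Fin 2 → ℤ
/-- The (negative definite) `E8` lattice, as `ℤ⁸`. -/
abbrev E8Lat := Fin 8 → ℤ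

/-- Gram matrix of the hyperbolic plane `U`. -/
def Ugram : Matrix (Fin 2) (Fin 2) ℤ := !![0,1;1,0]

/-- Gram matrix of the negative definite `E8` lattice (negative of the E8 Cartan matrix,
in Bourbaki labeling). -/
def E8gram : Matrix (Fin 8) (Fin 8) ℤ :=
  !![-2,0,1,0,0,0,0,0;
     0,-2,0,1,0,0,0,0;
     1,0,-2,1,0,0,0,0;
     0,1,1,-2,1,0,0,0;
     0,0,0,1,-2,1,0,0;
     0,0,0,0,1,-2,1,0;
     0,0,0,0,0,1,-2,1;
     0,0,0,0,0,0,1,-2]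

/-- The bilinear form of `U`. -/
def Ubil : ULat →ₗ[ℤ] ULat →ₗ[ℤ] ℤ := Matrix.toLinearMap₂' ℤ Ugram
/-- The bilinear form of `E8`. -/
def E8bil : E8Lat →ₗ[ℤ] E8Lat →ₗ[ℤ] ℤ := Matrix.toLinearMap₂' ℤ E8gram

/-- Orthogonal direct sum of two bilinear forms. -/
def prodBil {M N : Type} [AddCommGroup M] [Module ℤ M] [AddCommGroup N] [Module ℤ N]
    (bM : M →ₗ[ℤ] M →ₗ[ℤ] ℤ) (bN : N →ₗ[ℤ] N →ₗ[ℤ] ℤ) :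
    (M × N) →ₗ[ℤ] (M × N) →ₗ[ℤ] ℤ :=
  LinearMap.mk₂ ℤ (fun x y => bM x.1 y.1 + bN x.2 y.2)
    (fun a b c => by simp [map_add]; ring)
    (fun r a b => by simp; ring)
    (fun a b c => by simp [map_add]; ring)
    (fun r a b => by simp; ring)

/-- Two (ℤ-)lattices with forms (valued in `R`) are isometric. -/
def IsometricForms {R M N : Type} [AddCommGroup M] [Module ℤ M] [AddCommGroup N] [Module ℤ N]
    (bM : M → M → R) (bN : N → N → R) : Prop :=
  ∃ e : M ≃ₗ[ℤ] N, ∀ x y, bN (e x) (e y) = bM x y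

/-- The K3 lattice `L = U ⊕ U ⊕ U ⊕ E8 ⊕ E8`. -/
abbrev K3Lat := ULat × ULat × ULat × E8Lat × E8Lat

/-- The bilinear form of the K3 lattice. -/
def K3bil : K3Lat →ₗ[ℤ] K3Lat →ₗ[ℤ] ℤ :=
  prodBil Ubil (prodBil Ubil (prodBil Ubil (prodBil E8bil E8bil)))

/-- The del Pezzo involution `(v,u,u',e,e') ↦ (-v,u',u,-e,-e')`` on the K3 lattice. -/
def IdP : K3Lat →ₗ[ℤ] K3Lat where
  toFun p := (-p.1, p.2.2.1, p.2.1, -p.2.2.2.1, -p.2.2.2.2)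
  map_add' a b := by simp [Prod.ext_iff, neg_add, add_comm]
  map_smul' c a := by simp [Prod.ext_iff]

/-- The fixed sublattice `L^{I=1}` of an involution. -/
def fixedLat {M : Type} [AddCommGroup M] [Module ℤ M] (f : M →ₗ[ℤ] M) : Submodule ℤ M :=
  LinearMap.ker (f - LinearMap.id)

/-- The anti-fixed sublattice `L^{I=-1}` of an involution. -/
def antifixedLat {M : Type} [AddCommGroup M] [Module ℤ M] (f : M →ₗ[ℤ] M) : Submodule ℤ M :=
  LinearMap.ker (f + LinearMap.id)

theorem prodBil_apply_aux {M N : Type} [AddCommGroup M] [Module ℤ M] [AddCommGroup N] [Module ℤ N]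
    (bM : M →ₗ[ℤ] M →ₗ[ℤ] ℤ) (bN : N →ₗ[ℤ] N →ₗ[ℤ] ℤ) (x y : M × N) :
    prodBil bM bN x y = bM x.1 y.1 + bN x.2 y.2 := rfl

theorem int_fun_neg_self {n : ℕ} {v : Fin n → ℤ} (h : -v = v) : v = 0 := by
  funext i
  have := congrFun h i
  simp only [Pi.neg_apply] at this
  simp only [Pi.zero_apply]
  omega

theorem mem_fixed_iff (p : K3Lat) : p ∈ fixedLat IdP ↔
    p.1 = 0 ∧ p.2.2.1 = p.2.1 ∧ p.2.2.2.1 = 0 ∧ p.2.2.2.2 = 0 := by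
  obtain ⟨v, u, u', e, e'⟩ := p
  have key : (v, u, u', e, e') ∈ fixedLat IdP ↔
      ((-v, u', u, -e, -e') : K3Lat) = (v, u, u', e, e') := by
    rw [fixedLat, LinearMap.mem_ker, LinearMap.sub_apply, sub_eq_zero]
    rfl
  rw [key]
  simp only [Prod.mk.injEq]
  constructor
  · rintro ⟨h1, h2, -, h4, h5⟩
    exact ⟨int_fun_neg_self h1, h2, int_fun_neg_self h4, int_fun_neg_self h5⟩
  · rintro ⟨rfl, rfl, rfl, rfl⟩
    simp

theorem mem_antifixed_iff (p : K3Lat) : p ∈ antifixedLat IdP ↔ p.2.2.1 = -p.2.1 := by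
  obtain ⟨v, u, u', e, e'⟩ := p
  have key : (v, u, u', e, e') ∈ antifixedLat IdP ↔
      ((-v, u', u, -e, -e') : K3Lat) = -(v, u, u', e, e') := by
    rw [antifixedLat, LinearMap.mem_ker, LinearMap.add_apply, add_eq_zero_iff_eq_neg]
    rfl
  rw [key]
  simp only [Prod.neg_mk, Prod.mk.injEq]
  constructor
  · rintro ⟨-, h, -⟩
    exact h
  · rintro rfl
    simp

/-- The fixed lattice is the diagonal copy of `U`. -/
def fixedEquiv : fixedLat IdP ≃ₗ[ℤ] ULat where
  toFun p := p.1.2.1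
  map_add' _ _ := rfl
  map_smul' _ _ := rfl
  invFun u := ⟨(0, u, u, 0, 0), (mem_fixed_iff _).2 ⟨rfl, rfl, rfl, rfl⟩⟩
  left_inv p := by
    obtain ⟨⟨v, u, u', e, e'⟩, hp⟩ := p
    obtain ⟨h1, h2, h3, h4⟩ := (mem_fixed_iff _).1 hp
    simp only at h1 h2 h3 h4
    subst h1 h2 h3 h4
    rfl
  right_inv _ := rfl

/-- The anti-fixed lattice, with the antidiagonal in the last two copies of `U`. -/
def antifixedEquiv : antifixedLat IdP ≃ₗ[ℤ] ULat × ULat × E8Lat × E8Lat where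
  toFun p := (p.1.1, p.1.2.1, p.1.2.2.2.1, p.1.2.2.2.2)
  map_add' _ _ := rfl
  map_smul' _ _ := rfl
  invFun q := ⟨(q.1, q.2.1, -q.2.1, q.2.2.1, q.2.2.2), (mem_antifixed_iff _).2 rfl⟩
  left_inv p := by
    obtain ⟨⟨v, u, u', e, e'⟩, hp⟩ := p
    have h := (mem_antifixed_iff _).1 hp
    simp only at h
    subst h
    rfl
  right_inv _ := rfl

theorem stmt1 :
    IsometricForms (fun x y : fixedLat IdP => K3bil x.1 y.1)
      (fun x y : ULat => ((2:ℤ) • Ubil) x y) ∧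
    IsometricForms (fun x y : antifixedLat IdP => K3bil x.1 y.1)
      (fun x y : ULat × ULat × E8Lat × E8Lat =>
        prodBil Ubil (prodBil ((2:ℤ) • Ubil) (prodBil E8bil E8bil)) x y) := by
  refine ⟨⟨fixedEquiv, ?_⟩, ⟨antifixedEquiv, ?_⟩⟩
  · rintro ⟨⟨v, u, u', e, e'⟩, hp⟩ ⟨⟨w, t, t', f, f'⟩, hq⟩
    obtain ⟨h1, h2, h3, h4⟩ := (mem_fixed_iff _).1 hp
    obtain ⟨k1, k2, k3, k4⟩ := (mem_fixed_iff _).1 hq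
    simp only at h1 h2 h3 h4 k1 k2 k3 k4
    subst h1 h2 h3 h4 k1 k2 k3 k4
    simp only [fixedEquiv, LinearEquiv.coe_mk, LinearMap.coe_mk, AddHom.coe_mk, K3bil,
      prodBil_apply_aux, LinearMap.smul_apply, smul_eq_mul, map_zero]
    ring
  · rintro ⟨⟨v, u, u', e, e'⟩, hp⟩ ⟨⟨w, t, t', f, f'⟩, hq⟩
    have h := (mem_antifixed_iff _).1 hp
    have k := (mem_antifixed_iff _).1 hq
    simp only at h k
    subst h k
    simp only [antifixedEquiv, LinearEquiv.coe_mk, LinearMap.coe_mk, AddHom.coe_mk, K3bil,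
      prodBil_apply_aux, LinearMap.smul_apply, smul_eq_mul, map_neg, LinearMap.neg_apply]
    ring
end
end

section
/- Let T_dP = U ⊕ U(2) ⊕ E8 ⊕ E8 with involution I(v,u,e,e') = (v,u,-e',-e). If α ∈ T_dP is a root with α·α = -4 and divisibility 2, and I(α) ≠ α, then (α + I(α))·(α + I(α)) ≥ 0; i.e. the folded vector of a (-4)-root is never again a negative vector. -/
noncomputable section

/-- The lattice `T_dP = U ⊕ U(2) ⊕ E8 ⊕ E8`. -/
abbrev TdPLat := ULat × ULat × E8Lat × E8Lat

/-- The bilinear form of `T_dP = U ⊕ U(2) ⊕ E8 ⊕ E8`. -/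
def TdPbil : TdPLat →ₗ[ℤ] TdPLat →ₗ[ℤ] ℤ :=
  prodBil Ubil (prodBil ((2:ℤ) • Ubil) (prodBil E8bil E8bil))

/-- The involution `I(v,u,e,e') = (v,u,-e',-e)` on `T_dP`. -/
def ITdP : TdPLat →ₗ[ℤ] TdPLat where
  toFun p := (p.1, p.2.1, -p.2.2.2, -p.2.2.1)
  map_add' a b := by simp [Prod.ext_iff, neg_add, add_comm]
  map_smul' c a := by simp [Prod.ext_iff]

/-- The fixed sublattice `T_enr = T_dP^{I=1} = {(v,u,e,-e)} ≅ U ⊕ U(2) ⊕ E8(2)`. -/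
def TenrLat : Submodule ℤ TdPLat := LinearMap.ker (ITdP - LinearMap.id)

/-- Explicit formula for the form of `U`. -/
lemma Ubil_apply (x y : ULat) : Ubil x y = x 0 * y 1 + x 1 * y 0 := by
  simp [Ubil, Ugram, Matrix.toLinearMap₂'_apply, Fin.sum_univ_succ]

/-- Explicit formula for the form of `E8`. -/
lemma E8bil_apply (x y : E8Lat) : E8bil x y =
    (-2 * x 0 + x 2) * y 0 + (-2 * x 1 + x 3) * y 1 + (x 0 - 2 * x 2 + x 3) * y 2
    + (x 1 + x 2 - 2 * x 3 + x 4) * y 3 + (x 3 - 2 * x 4 + x 5) * y 4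
    + (x 4 - 2 * x 5 + x 6) * y 5 + (x 5 - 2 * x 6 + x 7) * y 6 + (x 6 - 2 * x 7) * y 7 := by
  simp [E8bil, E8gram, Matrix.toLinearMap₂'_apply, Fin.sum_univ_eight]
  ring

lemma TdPbil_apply (x y : TdPLat) : TdPbil x y =
    Ubil x.1 y.1 + (2 * Ubil x.2.1 y.2.1 + (E8bil x.2.2.1 y.2.2.1 + E8bil x.2.2.2 y.2.2.2)) := by
  simp [TdPbil, prodBil]

/-- A nonzero vector of `E8` has square at most `-2`. -/
lemma E8_neg (g : E8Lat) (hg : g ≠ 0) : E8bil g g ≤ -2 := by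
  by_contra hcon
  apply hg
  have hsq : 60 * E8bil g g = -(30 * (2 * g 0 - g 2) ^ 2 + 10 * (3 * g 2 - 2 * g 3) ^ 2
      + 30 * (2 * g 1 - g 3) ^ 2 + 2 * (5 * g 3 - 6 * g 4) ^ 2 + 3 * (4 * g 4 - 5 * g 5) ^ 2
      + 5 * (3 * g 5 - 4 * g 6) ^ 2 + 10 * (2 * g 6 - 3 * g 7) ^ 2 + 30 * g 7 ^ 2) := by
    rw [E8bil_apply]; ring
  have hev : ∃ k, E8bil g g = 2 * k :=
    ⟨-(g 0 ^ 2 + g 1 ^ 2 + g 2 ^ 2 + g 3 ^ 2 + g 4 ^ 2 + g 5 ^ 2 + g 6 ^ 2 + g 7 ^ 2)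
      + g 0 * g 2 + g 1 * g 3 + g 2 * g 3 + g 3 * g 4 + g 4 * g 5 + g 5 * g 6 + g 6 * g 7, by
      rw [E8bil_apply]; ring⟩
  obtain ⟨k, hk⟩ := hev
  have h0 : 0 ≤ E8bil g g := by omega
  have a1 := sq_nonneg (2 * g 0 - g 2)
  have a2 := sq_nonneg (3 * g 2 - 2 * g 3)
  have a3 := sq_nonneg (2 * g 1 - g 3)
  have a4 := sq_nonneg (5 * g 3 - 6 * g 4)
  have a5 := sq_nonneg (4 * g 4 - 5 * g 5)
  have a6 := sq_nonneg (3 * g 5 - 4 * g 6)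
  have a7 := sq_nonneg (2 * g 6 - 3 * g 7)
  have a8 := sq_nonneg (g 7)
  have b1 : 2 * g 0 - g 2 = 0 := pow_eq_zero_iff two_ne_zero |>.1 (by linarith)
  have b2 : 3 * g 2 - 2 * g 3 = 0 := pow_eq_zero_iff two_ne_zero |>.1 (by linarith)
  have b3 : 2 * g 1 - g 3 = 0 := pow_eq_zero_iff two_ne_zero |>.1 (by linarith)
  have b4 : 5 * g 3 - 6 * g 4 = 0 := pow_eq_zero_iff two_ne_zero |>.1 (by linarith)
  have b5 : 4 * g 4 - 5 * g 5 = 0 := pow_eq_zero_iff two_ne_zero |>.1 (by linarith)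
  have b6 : 3 * g 5 - 4 * g 6 = 0 := pow_eq_zero_iff two_ne_zero |>.1 (by linarith)
  have b7 : 2 * g 6 - 3 * g 7 = 0 := pow_eq_zero_iff two_ne_zero |>.1 (by linarith)
  have b8 : g 7 = 0 := pow_eq_zero_iff two_ne_zero |>.1 (by linarith)
  ext i
  fin_cases i <;> simp <;> omega

/-- `E8` is unimodular modulo 2: a vector of even divisibility lies in `2 E8`. -/
lemma E8_even (e : E8Lat) (h : ∀ x, (2 : ℤ) ∣ E8bil e x) : ∃ f : E8Lat, e = (2 : ℤ) • f := by
  have k0 := h (Pi.single 0 1)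
  have k1 := h (Pi.single 1 1)
  have k2 := h (Pi.single 2 1)
  have k3 := h (Pi.single 3 1)
  have k4 := h (Pi.single 4 1)
  have k5 := h (Pi.single 5 1)
  have k6 := h (Pi.single 6 1)
  have k7 := h (Pi.single 7 1)
  simp [E8bil_apply] at k0 k1 k2 k3 k4 k5 k6 k7
  refine ⟨fun i => e i / 2, ?_⟩
  clear h
  have d2 : 2 ∣ e 2 := by
    clear k1 k2 k3 k4 k5 k6 k7
    omega
  clear k0
  have d3 : 2 ∣ e 3 := by
    clear k2 k3 k4 k5 k6 k7 d2
    omega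
  clear k1
  have d0 : 2 ∣ e 0 := by
    clear k3 k4 k5 k6 k7
    omega
  clear k2
  have d5 : 2 ∣ e 5 := by
    clear k3 k5 k6 k7 d2 d0
    omega
  clear k4
  have d7 : 2 ∣ e 7 := by
    clear k3 k5 k7 d2 d3 d0
    omega
  clear k6
  have d6 : 2 ∣ e 6 := by
    clear k3 k5 d2 d3 d0 d5 d7
    omega
  clear k7
  have d4 : 2 ∣ e 4 := by
    clear k3 d2 d3 d0 d5 d7
    omega
  clear k5
  have d1 : 2 ∣ e 1 := by
    clear d3 d0 d5 d7 d6
    omega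
  clear k3
  ext i
  fin_cases i <;> simp <;> omega

/-- If `α` is a (-4)-root of divisibility 2 in `T_dP` and `I(α) ≠ α`, then the folded vector
`α + I(α)` has nonnegative square: the folded vector of a (-4)-root is never again negative. -/
theorem stmt7 (α : TdPLat) (h4 : TdPbil α α = -4)
    (hdvd : ∀ x : TdPLat, (2:ℤ) ∣ TdPbil α x) (hgen : ∃ x : TdPLat, TdPbil α x = 2)
    (hne : ITdP α ≠ α) :
    0 ≤ TdPbil (α + ITdP α) (α + ITdP α) := by
  obtain ⟨v, u, e, e'⟩ := α
  obtain ⟨f, rfl⟩ : ∃ f : E8Lat, e = (2 : ℤ) • f := E8_even e fun x => by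
    simpa [TdPbil_apply] using hdvd (0, 0, x, 0)
  obtain ⟨f', rfl⟩ : ∃ f : E8Lat, e' = (2 : ℤ) • f := E8_even e' fun x => by
    simpa [TdPbil_apply] using hdvd (0, 0, 0, x)
  have hg : f + f' ≠ 0 := by
    intro h
    apply hne
    have h' : f' = -f := (neg_eq_of_add_eq_zero_right h).symm
    subst h'
    simp [ITdP]
  have key := E8_neg _ hg
  have hI : ITdP (v, u, (2 : ℤ) • f, (2 : ℤ) • f') =
      (v, u, -((2 : ℤ) • f'), -((2 : ℤ) • f)) := rfl
  rw [hI]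
  simp only [TdPbil_apply, Prod.mk_add_mk, map_add, map_neg, map_smul, LinearMap.add_apply,
    LinearMap.neg_apply, LinearMap.smul_apply, smul_eq_mul] at h4 key ⊢
  linarith
end
end
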